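/- arXiv:2307.03785 — 2 statements merged into one kernel-verified Lean document; each statement's English description precedes it below -/
import Mathlib

section
/- Let p be a prime and A = 𝔽_p[t_1,...,t_p, x_0,...,x_p]/(x_0^p − t_1 x_1^p − ··· − t_p x_p^p). Then for each i with 1 ≤ i ≤ p, the localization A_{x_i} is a regular ring. -/
open MvPolynomial

/-- A (noetherian) local ring is regular if its maximal ideal can be generated by
`dim R` elements. -/
def IsRegularLocalRingS (R : Type*) [CommRing R] [IsLocalRing R] : Prop :=
  IsNoetherianRing R ∧ ∃ s : Finset R,
    Ideal.span (s : Set R) = IsLocalRing.maximalIdeal R ∧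
      (s.card : WithBot ℕ∞) = ringKrullDim R

/-- A commutative ring is regular if its localization at every prime ideal is a
regular local ring. -/
def IsRegularRingS (R : Type*) [CommRing R] : Prop :=
  ∀ (P : Ideal R) [P.IsPrime], IsRegularLocalRingS (Localization.AtPrime P)

lemma regS_of_isRegularLocalRing (R : Type*) [CommRing R] [IsLocalRing R]
    (h : IsRegularLocalRing R) : IsRegularLocalRingS R := by
  refine ⟨inferInstance, ?_⟩
  have fg := (IsLocalRing.maximalIdeal R).fg_of_isNoetherianRing
  have fin := Submodule.FG.finite_generators fg
  refine ⟨fin.toFinset, ?_, ?_⟩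
  · rw [Set.Finite.coe_toFinset]
    exact (IsLocalRing.maximalIdeal R).span_generators
  · rw [← (isRegularLocalRing_iff R).mp h, ← Submodule.FG.generators_ncard fg,
      Set.ncard_eq_toFinset_card _ fin]

lemma isRegularRing_of_isLocalization {R S : Type*} [CommRing R] [CommRing S] [Algebra R S]
    (M : Submonoid R) [IsLocalization M S] [IsRegularRing R] : IsRegularRing S := by
  have := IsLocalization.isNoetherianRing M S inferInstance
  rw [isRegularRing_iff]
  intro P hP
  have := IsLocalization.isLocalization_isLocalization_atPrime_isLocalization M
      (Localization.AtPrime P) P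
  exact IsRegularLocalRing.of_ringEquiv (IsLocalization.algEquiv (P.under R).primeCompl
    (Localization.AtPrime (P.under R)) (Localization.AtPrime P)).toRingEquiv

lemma isRegularRing_hypersurface {k ι κ : Type*} [Field k] [Fintype ι] [Finite κ]
    (n : ℕ) (z : κ) (s : ι → κ) (i : ι) :
    IsRegularRing (Localization.Away (Ideal.Quotient.mk (Ideal.span
      {(X (Sum.inr z) ^ n - ∑ j : ι, X (Sum.inl j) * X (Sum.inr (s j)) ^ n :
        MvPolynomial (ι ⊕ κ) k)}) (X (Sum.inr (s i))))) := by
  classical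
  set f : MvPolynomial (ι ⊕ κ) k :=
    X (Sum.inr z) ^ n - ∑ j : ι, X (Sum.inl j) * X (Sum.inr (s j)) ^ n with hf
  let σ := {v : ι ⊕ κ // v ≠ Sum.inl i}
  let B := MvPolynomial σ k
  let a : B := X ⟨Sum.inr (s i), by simp⟩
  let L := Localization.Away a
  let A := MvPolynomial (ι ⊕ κ) k ⧸ Ideal.span {f}
  let xa : A := Ideal.Quotient.mk _ (X (Sum.inr (s i)))
  let LA := Localization.Away xa
  let u : L := IsLocalization.Away.invSelf a
  have hu : algebraMap B L a * u = 1 := IsLocalization.Away.mul_invSelf a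
  let y : {v : ι ⊕ κ // v ≠ Sum.inl i} → L := fun v => algebraMap B L (X v)
  let w : ι → L := fun j => if h : j = i then 0 else y ⟨Sum.inl j, by simpa using h⟩
  let x : κ → L := fun c => y ⟨Sum.inr c, by simp⟩
  let T : L := u ^ n * (x z ^ n - ∑ j, w j * x (s j) ^ n)
  let vals : ι ⊕ κ → L := Sum.elim (fun j => if j = i then T else w j) x
  let φ₀ : MvPolynomial (ι ⊕ κ) k →+* L := eval₂Hom ((algebraMap B L).comp C) vals
  have hφf : φ₀ f = 0 := by
    have h1 : φ₀ f = x z ^ n - ∑ j, (if j = i then T else w j) * x (s j) ^ n := by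
      simp [φ₀, hf, vals]
    have h2 : ∑ j, (if j = i then T else w j) * x (s j) ^ n
        = T * x (s i) ^ n + ∑ j, w j * x (s j) ^ n := by
      have : ∀ j, (if j = i then T else w j) * x (s j) ^ n
          = (if j = i then T * x (s i) ^ n else 0) + w j * x (s j) ^ n := by
        intro j
        by_cases h : j = i
        · subst h; simp [w]
        · simp [h]
      simp only [this, Finset.sum_add_distrib, Finset.sum_ite_eq', Finset.mem_univ, if_true]
    have h3 : u ^ n * x (s i) ^ n = 1 := by
      rw [← mul_pow, mul_comm]
      change (algebraMap B L a * u) ^ n = 1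
      rw [hu, one_pow]
    rw [h1, h2]
    linear_combination (-(x z ^ n - ∑ j, w j * x (s j) ^ n)) * h3
  let φ₁ : A →+* L := Ideal.Quotient.lift _ φ₀ (by
    intro c hc
    obtain ⟨d, rfl⟩ := Ideal.mem_span_singleton.mp hc
    rw [map_mul, hφf, zero_mul])
  have hφ₁ : ∀ r, φ₁ (Ideal.Quotient.mk _ r) = φ₀ r := fun r => Ideal.Quotient.lift_mk _ _ _
  have hφX : ∀ v, φ₀ (X v) = vals v := fun v => by simp [φ₀]
  have hunit : IsUnit (φ₁ xa) := by
    rw [hφ₁, hφX]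
    exact IsLocalization.Away.algebraMap_isUnit a
  let φ : LA →+* L := IsLocalization.Away.lift xa hunit
  have hφ : ∀ r, φ (algebraMap A LA r) = φ₁ r := fun r => IsLocalization.Away.lift_eq xa hunit r
  let q : MvPolynomial (ι ⊕ κ) k →+* LA := (algebraMap A LA).comp (Ideal.Quotient.mk _)
  let ψ₀ : B →+* LA := q.comp (rename (Subtype.val : σ → ι ⊕ κ)).toRingHom
  have hψX : ∀ v : σ, ψ₀ (X v) = q (X v.1) := fun v =>
    congrArg q (rename_X _ v)
  have hψC : ∀ r : k, ψ₀ (C r) = q (C r) := fun r => congrArg q (rename_C _ r)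
  have hunit' : IsUnit (ψ₀ a) := by
    rw [hψX]
    exact IsLocalization.Away.algebraMap_isUnit xa
  let ψ : L →+* LA := IsLocalization.Away.lift a hunit'
  have hψ : ∀ r, ψ (algebraMap B L r) = ψ₀ r := fun r => IsLocalization.Away.lift_eq a hunit' r
  have hφq : ∀ r, φ (q r) = φ₀ r := fun r => by
    exact (hφ _).trans (hφ₁ r)
  have hψy : ∀ v, ψ (y v) = q (X v.1) := fun v => by rw [hψ, hψX]
  have e1 : φ.comp ψ = RingHom.id L := by
    apply IsLocalization.ringHom_ext (Submonoid.powers a)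
    apply MvPolynomial.ringHom_ext
    · intro r
      simp only [RingHom.comp_apply, hψ, RingHom.id_apply, hψC, hφq]
      simp [φ₀]
    · rintro ⟨v, hv⟩
      simp only [RingHom.comp_apply, RingHom.id_apply, hψ, hψX, hφq, hφX]
      rcases v with j | c
      · have hj : j ≠ i := by simpa using hv
        simp [vals, hj, w, y]
      · simp [vals, x, y]
  have e2 : ψ.comp φ = RingHom.id LA := by
    apply IsLocalization.ringHom_ext (Submonoid.powers xa)
    apply Ideal.Quotient.ringHom_ext
    apply MvPolynomial.ringHom_ext
    · intro r
      change ψ (φ (q (C r))) = q (C r)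
      rw [hφq]
      simp [φ₀, hψ, hψC]
    · intro v
      change ψ (φ (q (X v))) = q (X v)
      rw [hφq, hφX]
      rcases v with j | c
      · by_cases hj : j = i
        · subst hj
          have hq : q f = 0 := by
            change algebraMap A LA (Ideal.Quotient.mk _ f) = 0
            rw [Ideal.Quotient.eq_zero_iff_mem.mpr (Ideal.mem_span_singleton_self f), map_zero]
          have hw : ∀ l, ψ (w l) = if l = j then 0 else q (X (Sum.inl l)) := by
            intro l
            by_cases h : l = j
            · simp [w, h]
            · simp [w, h, hψy]
          have hx : ∀ c, ψ (x c) = q (X (Sum.inr c)) := fun c => hψy _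
          have hu' : q (X (Sum.inr (s j))) * ψ u = 1 := by
            rw [← hx, ← map_mul]
            exact (congrArg ψ hu).trans (map_one _)
          have hs : ∑ l, q (X (Sum.inl l)) * q (X (Sum.inr (s l))) ^ n
              = q (X (Sum.inl j)) * q (X (Sum.inr (s j))) ^ n
                + ∑ l, (if l = j then 0 else q (X (Sum.inl l))) * q (X (Sum.inr (s l))) ^ n := by
            have : ∀ l, q (X (Sum.inl l)) * q (X (Sum.inr (s l))) ^ n
              = (if l = j then q (X (Sum.inl j)) * q (X (Sum.inr (s j))) ^ n else 0)
                + (if l = j then 0 else q (X (Sum.inl l))) * q (X (Sum.inr (s l))) ^ n := by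
              intro l
              by_cases h : l = j
              · subst h; simp
              · simp [h]
            rw [Finset.sum_congr rfl (fun l _ => this l), Finset.sum_add_distrib,
              Finset.sum_ite_eq']
            simp only [Finset.mem_univ, if_true]
          replace hq := (congrArg q hf).symm.trans hq
          rw [map_sub, map_pow, map_sum] at hq
          simp only [map_mul, map_pow] at hq
          rw [hs] at hq
          have hT : ψ (vals (Sum.inl j)) = ψ u ^ n * (q (X (Sum.inr z)) ^ n -
              ∑ l, (if l = j then 0 else q (X (Sum.inl l))) * q (X (Sum.inr (s l))) ^ n) := by
            simp only [vals, Sum.elim_inl, if_true, T, map_mul, map_pow, map_sub, map_sum, hw, hx]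
          have h3 : q (X (Sum.inr (s j))) ^ n * ψ u ^ n = 1 := by
            rw [← mul_pow, hu', one_pow]
          rw [hT]
          linear_combination (ψ u ^ n) * hq + q (X (Sum.inl j)) * h3
        · simp [vals, hj, w, hψy]
      · exact hψy _
  have : IsRegularRing L := isRegularRing_of_isLocalization (Submonoid.powers a)
  exact IsRegularRing.of_ringEquiv (RingEquiv.ofRingHom ψ φ e2 e1)

/-- Let `A = 𝔽_p[t₁,...,t_p, x₀,...,x_p]/(x₀ᵖ - t₁x₁ᵖ - ⋯ - t_p x_pᵖ)` (with
`t i = X (Sum.inl i)` and `x j = X (Sum.inr j)`).  Then for each `i` with `1 ≤ i ≤ p`,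
the localization `A_{xᵢ}` is a regular ring. -/
theorem stmt_4 (p : ℕ) (hp : p.Prime) :
    letI : Fact p.Prime := ⟨hp⟩
    let t : Fin p → MvPolynomial (Fin p ⊕ Fin (p + 1)) (ZMod p) := fun i => X (Sum.inl i)
    let x : Fin (p + 1) → MvPolynomial (Fin p ⊕ Fin (p + 1)) (ZMod p) := fun j => X (Sum.inr j)
    let A := MvPolynomial (Fin p ⊕ Fin (p + 1)) (ZMod p) ⧸
      Ideal.span {x 0 ^ p - ∑ i : Fin p, t i * x i.succ ^ p}
    ∀ i : Fin p, IsRegularRingS (Localization.Away (Ideal.Quotient.mk _ (x i.succ) : A)) := by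
  haveI : Fact p.Prime := ⟨hp⟩
  intro t x A i P hP
  have := isRegularRing_hypersurface (k := ZMod p) p (0 : Fin (p + 1)) (Fin.succ : Fin p → _) i
  exact regS_of_isRegularLocalRing _ (this.isRegularLocalRing_localization P)
end

section
/- Let p be a prime and A = 𝔽_p[t_1,...,t_p, x_0,...,x_p]/(x_0^p − t_1 x_1^p − ··· − t_p x_p^p). Then A is a normal domain. -/
open MvPolynomial

namespace NormalAux

lemma isDomain_of {R A : Type*} [CommRing R] [IsDomain R] [CommRing A]
    (f : R →+* A) (hf : Function.Injective f) (a : R)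
    (ha : ∀ z, f a * z = 0 → z = 0) (hz : ∀ z, ∃ (N : ℕ) (r : R), f a ^ N * z = f r) :
    IsDomain A := by
  have hpow : ∀ (N : ℕ) z, f a ^ N * z = 0 → z = 0 := by
    intro N
    induction N with
    | zero => intro z h; simpa using h
    | succ n ih =>
      intro z h
      rw [pow_succ, mul_assoc] at h
      exact ha _ (ih _ h)
  have : Nontrivial A := hf.nontrivial
  have : NoZeroDivisors A := by
    constructor
    intro u v huv
    obtain ⟨N, r, hr⟩ := hz u
    obtain ⟨M, s, hs⟩ := hz v
    have : f (r * s) = 0 := by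
      rw [map_mul, ← hr, ← hs, mul_mul_mul_comm, huv, mul_zero]
    rw [map_eq_zero_iff f hf] at this
    rcases mul_eq_zero.mp this with h | h
    · left; apply hpow N; rw [hr, h, map_zero]
    · right; apply hpow M; rw [hs, h, map_zero]
  exact NoZeroDivisors.to_isDomain A

lemma exists_pow_mul {R A K : Type*} [CommRing R] [IsDomain R] [IsIntegrallyClosed R]
    [CommRing A] [IsDomain A] [Field K] [Algebra A K] [IsFractionRing A K]
    (f : R →+* A) (hf : Function.Injective f) (a : R) (ha : a ≠ 0)
    (hz : ∀ z, ∃ (N : ℕ) (r : R), f a ^ N * z = f r) (y : K) (hy : IsIntegral A y) :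
    ∃ (N : ℕ) (u : A), algebraMap A K (f a) ^ N * y = algebraMap A K u := by
  letI : Algebra R K := ((algebraMap A K).comp f).toAlgebra
  have hmap : ∀ r, algebraMap R K r = algebraMap A K (f r) := fun _ => rfl
  have hAK := IsFractionRing.injective A K
  have hRK : Function.Injective (algebraMap R K) := hAK.comp hf
  have hfa : f a ≠ 0 := by rwa [Ne, map_eq_zero_iff f hf]
  have hfaK : algebraMap A K (f a) ≠ 0 := by rwa [Ne, map_eq_zero_iff _ hAK]
  haveI : FaithfulSMul R K := (faithfulSMul_iff_algebraMap_injective R K).2 hRK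
  haveI : IsFractionRing R K := by
    apply IsFractionRing.of_field
    intro k
    obtain ⟨u, v, hv, rfl⟩ := IsFractionRing.div_surjective (A := A) k
    obtain ⟨N, r, hr⟩ := hz u
    obtain ⟨M, s, hs⟩ := hz v
    have hv0 : algebraMap A K v ≠ 0 := by
      rw [Ne, map_eq_zero_iff _ hAK]; exact nonZeroDivisors.ne_zero hv
    refine ⟨a ^ M * r, a ^ N * s, ?_⟩
    simp only [hmap, map_mul, map_pow, ← hr, ← hs]
    field_simp
  obtain ⟨g, hg, hgy⟩ := hy
  choose N r hr using hz
  let M := ∑ i ∈ Finset.range (g.natDegree + 1), N (g.coeff i)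
  have hM : ∀ i < g.natDegree, ∃ s, f s = g.coeff i * f a ^ M := by
    intro i hi
    have : N (g.coeff i) ≤ M := Finset.single_le_sum (f := fun i => N (g.coeff i))
      (fun _ _ => Nat.zero_le _) (Finset.mem_range.2 (by omega))
    obtain ⟨k, hk⟩ := Nat.exists_eq_add_of_le this
    refine ⟨r (g.coeff i) * a ^ k, ?_⟩
    rw [map_mul, ← hr, map_pow, hk, pow_add]; ring
  have hlift : g.scaleRoots (f a ^ M) ∈ Polynomial.lifts f := by
    rw [Polynomial.lifts_iff_coeff_lifts]
    intro i
    rw [Polynomial.coeff_scaleRoots]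
    rcases lt_trichotomy i g.natDegree with h | h | h
    · obtain ⟨s, hs⟩ := hM i h
      obtain ⟨k, hk⟩ := Nat.exists_eq_add_of_lt h
      refine ⟨s * (a ^ M) ^ k, ?_⟩
      have : g.natDegree - i = k + 1 := by omega
      rw [this, map_mul, hs, map_pow, map_pow, pow_succ]; ring
    · subst h
      exact ⟨1, by simp [hg.coeff_natDegree]⟩
    · exact ⟨0, by simp [Polynomial.coeff_eq_zero_of_natDegree_lt h]⟩
  obtain ⟨q, hq, -, hqm⟩ := Polynomial.lifts_and_degree_eq_and_monic hlift
    ((Polynomial.monic_scaleRoots_iff _).2 hg)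
  have hint : IsIntegral R (algebraMap A K (f a ^ M) * y) := by
    refine ⟨q, hqm, ?_⟩
    have h1 := Polynomial.scaleRoots_eval₂_eq_zero (s := f a ^ M) (algebraMap A K) hgy
    rw [← hq, Polynomial.eval₂_map] at h1
    exact h1
  obtain ⟨s, hs⟩ := IsIntegrallyClosed.isIntegral_iff.1 hint
  exact ⟨M, f s, by rw [← map_pow, ← hs]; rfl⟩

lemma pow_dvd {A : Type*} [CommRing A] [IsDomain A] (a b : A) (ha : a ≠ 0)
    (h : ∀ c, a ∣ b * c → a ∣ c) (n m : ℕ) (c : A) (hc : a ^ n ∣ b ^ m * c) : a ^ n ∣ c := by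
  have h1 : ∀ m c, a ∣ b ^ m * c → a ∣ c := by
    intro m
    induction m with
    | zero => intro c hc; simpa using hc
    | succ k ih =>
      intro c hc
      rw [pow_succ, mul_assoc] at hc
      exact h _ (ih _ hc)
  induction n generalizing c with
  | zero => simp
  | succ k ih =>
    have : a ∣ c := h1 m c ((dvd_pow_self a (by omega)).trans hc)
    obtain ⟨d, rfl⟩ := this
    rw [pow_succ', mul_left_comm] at hc
    rw [pow_succ']
    exact mul_dvd_mul_left a (ih d ((mul_dvd_mul_iff_left ha).1 hc))

lemma isIntegrallyClosed_of {A : Type*} [CommRing A] [IsDomain A] (a b : A) (ha : a ≠ 0)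
    (hb : b ≠ 0) (h : ∀ c, a ∣ b * c → a ∣ c)
    (h1 : ∀ y : FractionRing A, IsIntegral A y → ∃ (N : ℕ) (u : A),
      algebraMap A (FractionRing A) a ^ N * y = algebraMap A _ u)
    (h2 : ∀ y : FractionRing A, IsIntegral A y → ∃ (N : ℕ) (u : A),
      algebraMap A (FractionRing A) b ^ N * y = algebraMap A _ u) :
    IsIntegrallyClosed A := by
  rw [isIntegrallyClosed_iff (FractionRing A)]
  intro y hy
  have hAK := IsFractionRing.injective A (FractionRing A)
  obtain ⟨n, u, hu⟩ := h1 y hy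
  obtain ⟨m, v, hv⟩ := h2 y hy
  have : b ^ m * u = a ^ n * v := by
    apply hAK
    rw [map_mul, map_mul, ← hu, ← hv, map_pow, map_pow]; ring
  obtain ⟨w, rfl⟩ := pow_dvd a b ha h n m u ⟨v, this⟩
  refine ⟨w, ?_⟩
  rw [map_mul, map_pow] at hu
  have h0 : algebraMap A (FractionRing A) a ^ n ≠ 0 :=
    pow_ne_zero _ (by rwa [Ne, map_eq_zero_iff _ hAK])
  exact (mul_left_cancel₀ h0 hu).symm

section
variable (p : ℕ) [Fact p.Prime]

abbrev P := MvPolynomial (Fin p ⊕ Fin (p + 1)) (ZMod p)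
noncomputable abbrev F : P p :=
  X (Sum.inr 0) ^ p - ∑ i : Fin p, X (Sum.inl i) * X (Sum.inr i.succ) ^ p
abbrev R (i : Fin p) := MvPolynomial {s : Fin p ⊕ Fin (p + 1) // s ≠ Sum.inl i} (ZMod p)
abbrev A := P p ⧸ Ideal.span {F p}

noncomputable def x (i : Fin p) : R p i := X ⟨Sum.inr i.succ, by simp⟩

noncomputable def ff (i : Fin p) : R p i →+* A p :=
  (Ideal.Quotient.mk (Ideal.span {F p})).comp
    (rename (R := ZMod p) (Subtype.val : {s // s ≠ Sum.inl i} → _)).toRingHom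

lemma ff_x (i : Fin p) : ff p i (x p i) = Ideal.Quotient.mk _ (X (Sum.inr i.succ)) := by
  simp [ff, x]

lemma ff_X (i : Fin p) (s) : ff p i (X s) = Ideal.Quotient.mk _ (X s.1) := by
  simp [ff]

/-- evaluation at `x₀ = 1`, everything else `0` -/
noncomputable def ev : P p →ₐ[ZMod p] ZMod p :=
  aeval (fun s => if s = Sum.inr 0 then 1 else 0)

lemma ev_F : ev p (F p) = 1 := by
  have := (Fact.out : p.Prime).ne_zero
  simp [ev, F, this]

lemma not_dvd (i : Fin p) : ¬ (X (Sum.inr i.succ) : P p) ∣ F p := by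
  rintro ⟨c, hc⟩
  have := congrArg (ev p) hc
  rw [ev_F, map_mul] at this
  simp [ev] at this

lemma regular (i : Fin p) (z : A p) (h : ff p i (x p i) * z = 0) : z = 0 := by
  obtain ⟨g, rfl⟩ := Ideal.Quotient.mk_surjective z
  rw [ff_x, ← map_mul, Ideal.Quotient.eq_zero_iff_dvd] at h
  rw [Ideal.Quotient.eq_zero_iff_dvd]
  obtain ⟨c, hc⟩ := h
  have hX : Prime (X (Sum.inr i.succ) : P p) := X_prime
  rcases hX.dvd_or_dvd ⟨g, hc.symm⟩ with h | ⟨d, rfl⟩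
  · exact absurd h (not_dvd p i)
  · refine ⟨d, mul_left_cancel₀ hX.ne_zero (hc.trans (by ring))⟩

lemma ff_inj (i : Fin p) : Function.Injective (ff p i) := by
  let K := FractionRing (P p)
  have hK := IsFractionRing.injective (P p) K
  let τ : K := algebraMap (P p) K (X (Sum.inr 0) ^ p -
    ∑ j ∈ Finset.univ.erase i, X (Sum.inl j) * X (Sum.inr j.succ) ^ p) /
      algebraMap (P p) K (X (Sum.inr i.succ)) ^ p
  let φ : P p →ₐ[ZMod p] K := aeval
    (fun s => if s = Sum.inl i then τ else algebraMap (P p) K (X s))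
  have h0 : algebraMap (P p) K (X (Sum.inr i.succ)) ≠ 0 := by
    rw [Ne, map_eq_zero_iff _ hK]; exact X_ne_zero _
  have hF : φ (F p) = 0 := by
    simp only [F, map_sub, map_sum, ← Finset.add_sum_erase _ _ (Finset.mem_univ i), map_add]
    have : ∑ j ∈ Finset.univ.erase i, φ (X (Sum.inl j) * X (Sum.inr j.succ) ^ p) =
        ∑ j ∈ Finset.univ.erase i, algebraMap (P p) K (X (Sum.inl j) * X (Sum.inr j.succ) ^ p) := by
      refine Finset.sum_congr rfl fun j hj => ?_
      simp [φ, Finset.ne_of_mem_erase hj]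
    rw [this]
    simp only [φ, map_mul, map_pow, aeval_X, if_true, τ, reduceCtorEq, if_false]
    rw [div_mul_cancel₀ _ (pow_ne_zero _ h0)]
    simp only [map_sub, map_sum, map_mul, map_pow]
    ring
  have hφ : ∀ g : R p i, φ (rename Subtype.val g) = algebraMap (P p) K (rename Subtype.val g) := by
    intro g
    have : φ.comp (rename Subtype.val) =
        (Algebra.algHom (ZMod p) (P p) K).comp (rename (Subtype.val : {s // s ≠ Sum.inl i} → _)) := by
      apply MvPolynomial.algHom_ext
      intro s
      simp only [φ, AlgHom.comp_apply, rename_X, aeval_X, if_neg s.2]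
      rfl
    exact congrArg (fun h => h g) this
  rw [injective_iff_map_eq_zero]
  intro g hg
  have hg' : F p ∣ rename Subtype.val g := by
    rw [← Ideal.Quotient.eq_zero_iff_dvd]; exact hg
  obtain ⟨c, hc⟩ := hg'
  have h3 := hφ g
  rw [hc, map_mul, hF, zero_mul, ← hc] at h3
  have h4 := (map_eq_zero_iff _ hK).1 h3.symm
  exact (map_eq_zero_iff _ (rename_injective _ Subtype.val_injective)).1 h4

lemma gen (i : Fin p) (z : A p) : ∃ (N : ℕ) (r : R p i), ff p i (x p i) ^ N * z = ff p i r := by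
  obtain ⟨g, rfl⟩ := Ideal.Quotient.mk_surjective z
  induction g using MvPolynomial.induction_on with
  | C c => exact ⟨0, C c, by simp [ff]⟩
  | add u v hu hv =>
    obtain ⟨N, r, hr⟩ := hu
    obtain ⟨M, s, hs⟩ := hv
    refine ⟨N + M, x p i ^ M * r + x p i ^ N * s, ?_⟩
    rw [map_add, map_add, map_mul, map_mul, ← hr, ← hs, map_pow, map_pow]; ring
  | mul_X u s hu =>
    obtain ⟨N, r, hr⟩ := hu
    by_cases h : s = Sum.inl i
    · subst h
      refine ⟨N + p, r * (X ⟨Sum.inr 0, by simp⟩ ^ p -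
        ∑ j ∈ (Finset.univ.erase i).attach, X ⟨Sum.inl j.1, by
          simpa using Finset.ne_of_mem_erase j.2⟩ * X ⟨Sum.inr j.1.succ, by simp⟩ ^ p), ?_⟩
      have hF : Ideal.Quotient.mk (Ideal.span {F p}) (F p) = 0 := by
        rw [Ideal.Quotient.eq_zero_iff_dvd]
      have hF' : F p = X (Sum.inr 0) ^ p - (X (Sum.inl i) * X (Sum.inr i.succ) ^ p +
          ∑ j ∈ Finset.univ.erase i, X (Sum.inl j) * X (Sum.inr j.succ) ^ p) := by
        rw [F, ← Finset.add_sum_erase _ _ (Finset.mem_univ i)]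
      replace hF := (congrArg (Ideal.Quotient.mk (Ideal.span {F p})) hF').symm.trans hF
      simp only [map_mul, map_sub, map_sum, map_pow, ff_X, ← hr, map_add] at hF ⊢
      rw [Finset.sum_attach (Finset.univ.erase i) (fun j =>
        Ideal.Quotient.mk (Ideal.span {F p}) (X (Sum.inl j)) *
        Ideal.Quotient.mk (Ideal.span {F p}) (X (Sum.inr j.succ)) ^ p)]
      rw [ff_x, pow_add]
      linear_combination (-(Ideal.Quotient.mk (Ideal.span {F p}) (X (Sum.inr i.succ)) ^ N * Ideal.Quotient.mk (Ideal.span {F p}) u)) * hF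
    · exact ⟨N, r * X ⟨s, h⟩, by rw [map_mul, map_mul, ← hr, ff_X]; ring⟩

lemma regular2 (i j : Fin p) (hij : i ≠ j) (z : A p)
    (h : ff p i (x p i) ∣ ff p j (x p j) * z) : ff p i (x p i) ∣ z := by
  obtain ⟨g, rfl⟩ := Ideal.Quotient.mk_surjective z
  obtain ⟨w, hw⟩ := h
  obtain ⟨u, rfl⟩ := Ideal.Quotient.mk_surjective w
  rw [ff_x, ff_x, ← map_mul, ← map_mul, ← sub_eq_zero, ← map_sub,
    Ideal.Quotient.eq_zero_iff_dvd] at hw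
  obtain ⟨c, hc⟩ := hw
  let ψ : P p →ₐ[ZMod p] P p := aeval (fun s => if s = Sum.inr i.succ then 0 else X s)
  have hψ : ∀ g, (X (Sum.inr i.succ) : P p) ∣ g - ψ g := by
    intro g
    rw [← Ideal.Quotient.eq_zero_iff_dvd, map_sub, sub_eq_zero]
    have : Ideal.Quotient.mkₐ (ZMod p) (Ideal.span {(X (Sum.inr i.succ) : P p)}) =
      (Ideal.Quotient.mkₐ (ZMod p) (Ideal.span {(X (Sum.inr i.succ) : P p)})).comp ψ := by
      apply MvPolynomial.algHom_ext
      intro s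
      by_cases hs : s = Sum.inr i.succ
      · subst hs
        simp [ψ, Ideal.Quotient.eq_zero_iff_dvd]
      · simp [ψ, hs]
    exact congrArg (fun h => h g) this
  have hev : (ev p).comp ψ = ev p := by
    apply MvPolynomial.algHom_ext
    intro s
    by_cases hs : s = Sum.inr i.succ
    · subst hs
      simp [ψ, ev]
    · simp [ψ, hs]
  have hX : Prime (X (Sum.inr j.succ) : P p) := X_prime
  have hi : ψ (X (Sum.inr i.succ)) = 0 := by simp [ψ]
  have hj : ψ (X (Sum.inr j.succ)) = X (Sum.inr j.succ) := by simp [ψ, hij.symm]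
  have h1 := congrArg ψ hc
  rw [map_sub, map_mul, map_mul, map_mul, hi, hj, zero_mul, sub_zero] at h1
  have hnd : ¬ (X (Sum.inr j.succ) : P p) ∣ ψ (F p) := by
    rintro ⟨d, hd⟩
    have h2 := congrArg (ev p) hd
    have h3 : ev p (ψ (F p)) = ev p (F p) := congrArg (fun h => h (F p)) hev
    rw [h3, ev_F, map_mul] at h2
    simp [ev] at h2
  rcases hX.dvd_or_dvd ⟨ψ g, h1.symm⟩ with h | ⟨d, hd⟩
  · exact absurd h hnd
  rw [hd] at h1
  have h2 : ψ g = ψ (F p) * d := mul_left_cancel₀ hX.ne_zero (h1.trans (by ring))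
  obtain ⟨e, he⟩ := hψ g
  obtain ⟨k, hk⟩ := hψ (F p)
  have h4 : g = X (Sum.inr i.succ) * (e - k * d) + F p * d := by
    linear_combination he + h2 - d * hk
  have hF : Ideal.Quotient.mk (Ideal.span {F p}) (F p) = 0 := by
    rw [Ideal.Quotient.eq_zero_iff_dvd]
  refine ⟨Ideal.Quotient.mk _ (e - k * d), ?_⟩
  rw [ff_x, ← map_mul]
  conv_lhs => rw [h4, map_add, map_mul _ (F p), hF, zero_mul, add_zero]

lemma main : IsDomain (A p) ∧ IsIntegrallyClosed (A p) := by
  have h2 := (Fact.out : p.Prime).two_le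
  let i : Fin p := ⟨0, by omega⟩
  let j : Fin p := ⟨1, by omega⟩
  have hij : i ≠ j := by simp [i, j]
  have hx : ∀ i, x p i ≠ 0 := fun i => X_ne_zero _
  have hfx : ∀ i, ff p i (x p i) ≠ 0 := fun i => by
    rw [Ne, map_eq_zero_iff _ (ff_inj p i)]; exact hx i
  have hD : IsDomain (A p) := isDomain_of (ff p i) (ff_inj p i) (x p i) (regular p i) (gen p i)
  refine ⟨hD, ?_⟩
  exact isIntegrallyClosed_of _ _ (hfx i) (hfx j) (regular2 p i j hij)
    (exists_pow_mul (ff p i) (ff_inj p i) (x p i) (hx i) (gen p i))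
    (exists_pow_mul (ff p j) (ff_inj p j) (x p j) (hx j) (gen p j))

end
end NormalAux

/-- Let `A = 𝔽_p[t₁,...,t_p, x₀,...,x_p]/(x₀ᵖ - t₁x₁ᵖ - ⋯ - t_p x_pᵖ)` (with
`t i = X (Sum.inl i)` and `x j = X (Sum.inr j)`).  Then `A` is a normal domain,
i.e. an integral domain that is integrally closed in its fraction field. -/
theorem stmt_5 (p : ℕ) (hp : p.Prime) :
    letI : Fact p.Prime := ⟨hp⟩
    let t : Fin p → MvPolynomial (Fin p ⊕ Fin (p + 1)) (ZMod p) := fun i => X (Sum.inl i)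
    let x : Fin (p + 1) → MvPolynomial (Fin p ⊕ Fin (p + 1)) (ZMod p) := fun j => X (Sum.inr j)
    let A := MvPolynomial (Fin p ⊕ Fin (p + 1)) (ZMod p) ⧸
      Ideal.span {x 0 ^ p - ∑ i : Fin p, t i * x i.succ ^ p}
    IsDomain A ∧ IsIntegrallyClosed A := by
  haveI : Fact p.Prime := ⟨hp⟩
  exact NormalAux.main p
end
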